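/- There exists a partition of the vertex set of H(4,4) into sixteen codes each with parameters (4, 16, 3)_4 (MDS codes with minimum distance 3) that cannot be lengthened to a partition of the vertex set of H(5,4) into sixteen 1-perfect (5, 64, 3)_4 codes; i.e., there are no 1-perfect codes C_0,...,C_15 partitioning H(5,4) such that each B_i is obtained from C_i by shortening. -/

import Mathlib

namespace Part18

/-- The sixteen codes, words written in base 4 (coordinate `k` has weight `4^k`). -/
def tbl : List (List ℕ) :=
  [[9, 23, 46, 48, 66, 92, 101, 123, 143, 145, 168, 182, 196, 218, 227, 253],
   [12, 17, 39, 58, 75, 86, 96, 125, 133, 152, 174, 179, 194, 223, 233, 244],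
   [14, 16, 43, 53, 67, 93, 102, 120, 132, 154, 161, 191, 201, 215, 236, 242],
   [5, 30, 32, 59, 79, 84, 106, 113, 130, 153, 167, 188, 200, 211, 237, 246],
   [2, 21, 40, 63, 73, 94, 99, 116, 135, 144, 173, 186, 204, 219, 230, 241],
   [8, 19, 37, 62, 65, 90, 108, 119, 134, 157, 171, 176, 207, 212, 226, 249],
   [1, 22, 47, 56, 71, 80, 105, 126, 140, 155, 162, 181, 202, 221, 228, 243],
   [0, 29, 42, 55, 69, 88, 111, 114, 142, 147, 164, 185, 203, 214, 225, 252],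
   [4, 31, 41, 50, 74, 81, 103, 124, 141, 150, 160, 187, 195, 216, 238, 245],
   [15, 18, 36, 57, 70, 91, 109, 112, 136, 149, 163, 190, 193, 220, 234, 247],
   [7, 25, 34, 60, 77, 83, 104, 118, 138, 148, 175, 177, 192, 222, 229, 251],
   [3, 24, 38, 61, 68, 95, 97, 122, 137, 146, 172, 183, 206, 213, 235, 240],
   [6, 27, 44, 49, 72, 85, 98, 127, 131, 158, 169, 180, 205, 208, 231, 250],
   [10, 20, 45, 51, 76, 82, 107, 117, 129, 159, 166, 184, 199, 217, 224, 254],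
   [11, 28, 33, 54, 78, 89, 100, 115, 128, 151, 170, 189, 197, 210, 239, 248],
   [13, 26, 35, 52, 64, 87, 110, 121, 139, 156, 165, 178, 198, 209, 232, 255]]

/-- For the first seven codes, the xor-offsets of the three parallel codes. -/
def offs : List (ℕ × ℕ × ℕ) :=
  [(51, 54, 60),
   (99, 102, 105),
   (17, 23, 24),
   (35, 42, 44),
   (148, 155, 157),
   (178, 183, 189),
   (84, 91, 94)]

def tb (i : ℕ) : List ℕ := tbl.getD i []
def off (i : ℕ) : ℕ × ℕ × ℕ := offs.getD i (0, 0, 0)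

/-! ### Search -/

def filtK (x : ℕ) (k : List ℕ → Bool) (l : List ℕ) : List ℕ → Bool :=
  List.rec (motive := fun _ => List ℕ → Bool) (fun acc => k acc)
    (fun y _ ih acc => cond (Nat.beq (Nat.land x y) 0) (ih (y :: acc)) (ih acc)) l

def nonempK (k : List ℕ → Bool) (l : List ℕ) : Bool :=
  List.rec (motive := fun _ => Bool) true (fun _ _ _ => k l) l

def filtAllK (x : ℕ) (Ls : List (List ℕ)) : (List (List ℕ) → Bool) → Bool :=
  List.rec (motive := fun _ => (List (List ℕ) → Bool) → Bool) (fun k => k [])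
    (fun L _ ih k => filtK x (nonempK (fun L' => ih (fun Ls' => k (L' :: Ls')))) L []) Ls

def allK (f : ℕ → Bool) (l : List ℕ) : Bool :=
  List.rec (motive := fun _ => Bool) true (fun x _ ih => cond (f x) ih false) l

def refute (n : ℕ) : List (List ℕ) → Bool :=
  Nat.rec (motive := fun _ => List (List ℕ) → Bool) (fun _ => false)
    (fun _ ih Ls => List.rec (motive := fun _ => Bool) false
      (fun L Ls' _ => allK (fun x => filtAllK x Ls' ih) L) Ls) n

def forceN (n : ℕ) (k : ℕ → Bool) : Bool :=
  Nat.rec (motive := fun _ => Bool) (k 0) (fun m _ => k (Nat.succ m)) n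

def forceL (k : List ℕ → Bool) (l : List ℕ) : List ℕ → Bool :=
  List.rec (motive := fun _ => List ℕ → Bool) (fun acc => k acc)
    (fun y _ ih acc => forceN y (fun z => ih (z :: acc))) l

def forceA (Ls : List (List ℕ)) : (List (List ℕ) → Bool) → Bool :=
  List.rec (motive := fun _ => (List (List ℕ) → Bool) → Bool) (fun k => k [])
    (fun L _ ih k => forceL (fun L' => ih (fun Ls' => k (L' :: Ls'))) L []) Ls

/-! ### Candidates -/

def ins (j b n : ℕ) : ℕ := n % 4 ^ j + b * 4 ^ j + n / 4 ^ j * 4 ^ (j + 1)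

def piece (t : List ℕ) (o j b : ℕ) : ℕ :=
  t.foldr (fun m r => Nat.lor (Nat.shiftLeft 1 (ins j b (Nat.xor m o))) r) 0

def perms : List (ℕ × ℕ × ℕ × ℕ) :=
  [(0,1,2,3),(0,1,3,2),(0,2,1,3),(0,2,3,1),(0,3,1,2),(0,3,2,1),
   (1,0,2,3),(1,0,3,2),(1,2,0,3),(1,2,3,0),(1,3,0,2),(1,3,2,0),
   (2,0,1,3),(2,0,3,1),(2,1,0,3),(2,1,3,0),(2,3,0,1),(2,3,1,0),
   (3,0,1,2),(3,0,2,1),(3,1,0,2),(3,1,2,0),(3,2,0,1),(3,2,1,0)]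

def cand (t : List ℕ) (o : ℕ × ℕ × ℕ) (j : ℕ) (s : ℕ × ℕ × ℕ × ℕ) : ℕ :=
  Nat.lor (Nat.lor (piece t 0 j s.1) (piece t o.1 j s.2.1))
    (Nat.lor (piece t o.2.1 j s.2.2.1) (piece t o.2.2 j s.2.2.2))

def cands (t : List ℕ) (o : ℕ × ℕ × ℕ) : List ℕ :=
  [0, 1, 2, 3, 4].flatMap fun j => perms.map (cand t o j)

def seven : List (List ℕ) :=
  [cands (tb 0) (off 0), cands (tb 1) (off 1), cands (tb 2) (off 2), cands (tb 3) (off 3),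
   cands (tb 4) (off 4), cands (tb 5) (off 5), cands (tb 6) (off 6)]

set_option maxRecDepth 100000 in
theorem big : forceA seven (refute 7) = true := by decide +kernel

/-! ### Soundness of the search -/

theorem filtK_eq (x : ℕ) (k : List ℕ → Bool) (l acc : List ℕ) :
    filtK x k l acc = k ((l.filter (fun y => Nat.beq (Nat.land x y) 0)).reverse ++ acc) := by
  induction l generalizing acc with
  | nil => rfl
  | cons y l ih =>
    have h : filtK x k (y :: l) acc =
      cond (Nat.beq (Nat.land x y) 0) (filtK x k l (y :: acc)) (filtK x k l acc) := rfl
    rw [h, ih, ih]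
    rw [List.filter_cons]
    cases hb : Nat.beq (Nat.land x y) 0
    · rfl
    · simp only [cond_true, if_true, List.reverse_cons, List.append_assoc, List.singleton_append]

theorem nonempK_eq (k : List ℕ → Bool) (l : List ℕ) (h : nonempK k l = true) (x : ℕ)
    (hx : x ∈ l) : k l = true := by
  cases l with
  | nil => simp at hx
  | cons y l => exact h

theorem filtAllK_sound (x : ℕ) (Ls : List (List ℕ)) (k : List (List ℕ) → Bool)
    (h : filtAllK x Ls k = true) (xs : List ℕ) (hm : List.Forall₂ (· ∈ ·) xs Ls)
    (hd : ∀ y ∈ xs, Nat.land x y = 0) :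
    ∃ Ls', k Ls' = true ∧ List.Forall₂ (· ∈ ·) xs Ls' := by
  induction hm generalizing k with
  | nil => exact ⟨[], h, .nil⟩
  | @cons y L xs Ls hy hm ih =>
    have h' : filtK x (nonempK (fun L' => filtAllK x Ls (fun Ls' => k (L' :: Ls')))) L [] = true := h
    rw [filtK_eq] at h'
    have hmem : y ∈ (L.filter (fun y => Nat.beq (Nat.land x y) 0)).reverse ++ [] := by
      have := hd y (by simp)
      rw [List.append_nil, List.mem_reverse, List.mem_filter]
      exact ⟨hy, by rw [this]; rfl⟩
    have h2 := nonempK_eq _ _ h' y hmem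
    obtain ⟨Ls', h3, h4⟩ := ih _ h2 (fun z hz => hd z (by simp [hz]))
    exact ⟨_, h3, .cons hmem h4⟩

theorem allK_sound (f : ℕ → Bool) (l : List ℕ) (h : allK f l = true) (x : ℕ) (hx : x ∈ l) :
    f x = true := by
  induction l with
  | nil => simp at hx
  | cons y l ih =>
    have h' : cond (f y) (allK f l) false = true := h
    cases hy : f y
    · simp [hy] at h'
    · rw [hy] at h'
      rcases List.mem_cons.1 hx with rfl | hx
      · exact hy
      · exact ih h' hx

theorem refute_sound (n : ℕ) (Ls : List (List ℕ)) (h : refute n Ls = true) (xs : List ℕ)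
    (hm : List.Forall₂ (· ∈ ·) xs Ls) (hp : xs.Pairwise (fun x y => Nat.land x y = 0)) : False := by
  induction n generalizing Ls xs with
  | zero => simp [refute] at h
  | succ n ih =>
    cases hm with
    | nil => simp [refute] at h
    | @cons x L xs Ls hx hm =>
      have h' : allK (fun x => filtAllK x Ls (refute n)) L = true := h
      have h2 := allK_sound _ _ h' x hx
      rw [List.pairwise_cons] at hp
      obtain ⟨Ls', h3, h4⟩ := filtAllK_sound x Ls _ h2 xs hm hp.1
      exact ih Ls' h3 xs h4 hp.2

theorem forceN_eq (n : ℕ) (k : ℕ → Bool) : forceN n k = k n := by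
  cases n <;> rfl

theorem forceL_eq (k : List ℕ → Bool) (l acc : List ℕ) :
    forceL k l acc = k (l.reverse ++ acc) := by
  induction l generalizing acc with
  | nil => rfl
  | cons y l ih =>
    have h : forceL k (y :: l) acc = forceN y (fun z => forceL k l (z :: acc)) := rfl
    rw [h, forceN_eq, ih]
    simp

theorem forceA_sound (Ls : List (List ℕ)) (k : List (List ℕ) → Bool) (h : forceA Ls k = true)
    (xs : List ℕ) (hm : List.Forall₂ (· ∈ ·) xs Ls) :
    ∃ Ls', k Ls' = true ∧ List.Forall₂ (· ∈ ·) xs Ls' := by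
  induction hm generalizing k with
  | nil => exact ⟨[], h, .nil⟩
  | @cons y L xs Ls hy hm ih =>
    have h' : forceL (fun L' => forceA Ls (fun Ls' => k (L' :: Ls'))) L [] = true := h
    rw [forceL_eq] at h'
    obtain ⟨Ls', h3, h4⟩ := ih _ h'
    exact ⟨_, h3, .cons (by simpa using hy) h4⟩

/-! ### Words and numbers -/

def enc (x : Fin 4 → Fin 4) : ℕ := x 0 + 4 * x 1 + 16 * x 2 + 64 * x 3
def enc5 (x : Fin 5 → Fin 4) : ℕ := x 0 + 4 * x 1 + 16 * x 2 + 64 * x 3 + 256 * x 4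
def dec (n : ℕ) : Fin 4 → Fin 4 :=
  ![Fin.ofNat 4 n, Fin.ofNat 4 (n / 4), Fin.ofNat 4 (n / 16), Fin.ofNat 4 (n / 64)]

def hd (n m : ℕ) : ℕ :=
  (cond (Nat.beq (n % 4) (m % 4)) 0 1) + (cond (Nat.beq (n / 4 % 4) (m / 4 % 4)) 0 1) +
  (cond (Nat.beq (n / 16 % 4) (m / 16 % 4)) 0 1) + (cond (Nat.beq (n / 64 % 4) (m / 64 % 4)) 0 1)

theorem enc_dec (n : ℕ) (h : n < 256) : enc (dec n) = n := by
  simp [enc, dec, Fin.ofNat]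
  omega

theorem enc_lt (x : Fin 4 → Fin 4) : enc x < 256 := by
  simp only [enc]
  omega

theorem enc_inj : Function.Injective enc := by
  intro x y h
  simp only [enc] at h
  funext k
  fin_cases k <;> apply Fin.ext <;> simp <;> omega

theorem enc5_inj : Function.Injective enc5 := by
  intro x y h
  simp only [enc5] at h
  funext k
  fin_cases k <;> apply Fin.ext <;> simp <;> omega

theorem dec_enc (x : Fin 4 → Fin 4) : dec (enc x) = x :=
  enc_inj (enc_dec _ (enc_lt x))

theorem hd_enc (x y : Fin 4 → Fin 4) : hammingDist x y = hd (enc x) (enc y) := by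
  have e (x : Fin 4 → Fin 4) : enc x % 4 = x 0 ∧ enc x / 4 % 4 = x 1 ∧ enc x / 16 % 4 = x 2 ∧
      enc x / 64 % 4 = x 3 := by
    simp only [enc]; omega
  have hb (a b : Fin 4) : (cond (Nat.beq (a : ℕ) b) 0 1 : ℕ) = if a ≠ b then 1 else 0 := by
    revert a b; decide
  simp only [hd, e, hb]
  rw [hammingDist, Finset.card_filter, Fin.sum_univ_four]

theorem enc5_ins (j : Fin 5) (b : Fin 4) (w : Fin 4 → Fin 4) :
    enc5 (j.insertNth b w) = ins j b (enc w) := by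
  have e0 : (j.insertNth b w : Fin 5 → Fin 4) = fun k => (j.insertNth b w : Fin 5 → Fin 4) k := rfl
  fin_cases j
  · have h : (Fin.insertNth (0 : Fin 5) b w : Fin 5 → Fin 4) = ![b, w 0, w 1, w 2, w 3] := by
      funext k; fin_cases k <;> rfl
    simp only [Fin.zero_eta, h]
    simp [enc5, ins, enc]; omega
  · have h : (Fin.insertNth (1 : Fin 5) b w : Fin 5 → Fin 4) = ![w 0, b, w 1, w 2, w 3] := by
      funext k; fin_cases k <;> rfl
    simp only [Fin.mk_one, h]
    simp [enc5, ins, enc]; omega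
  · have h : (Fin.insertNth (2 : Fin 5) b w : Fin 5 → Fin 4) = ![w 0, w 1, b, w 2, w 3] := by
      funext k; fin_cases k <;> rfl
    simp only [Fin.reduceFinMk, h]
    simp [enc5, ins, enc]; omega
  · have h : (Fin.insertNth (3 : Fin 5) b w : Fin 5 → Fin 4) = ![w 0, w 1, w 2, b, w 3] := by
      funext k; fin_cases k <;> rfl
    simp only [Fin.reduceFinMk, h]
    simp [enc5, ins, enc]; omega
  · have h : (Fin.insertNth (4 : Fin 5) b w : Fin 5 → Fin 4) = ![w 0, w 1, w 2, w 3, b] := by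
      funext k; fin_cases k <;> rfl
    simp only [Fin.reduceFinMk, h]
    simp [enc5, ins, enc]; omega

theorem hd_ins (j : Fin 5) (b b' : Fin 4) (w w' : Fin 4 → Fin 4) :
    hammingDist (j.insertNth b w : Fin 5 → Fin 4) (j.insertNth b' w' : Fin 5 → Fin 4) =
      (if b ≠ b' then 1 else 0) + hammingDist w w' := by
  rw [hammingDist, hammingDist, Finset.card_filter, Finset.card_filter, Fin.sum_univ_succAbove _ j]
  simp

/-! ### Perfect codes -/

def Perf (C : Finset (Fin 5 → Fin 4)) : Prop :=
  ∀ x : Fin 5 → Fin 4, ∃! c, c ∈ C ∧ hammingDist x c ≤ 1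

theorem perf_dist (C : Finset (Fin 5 → Fin 4)) (hC : Perf C) (c c' : Fin 5 → Fin 4)
    (hc : c ∈ C) (hc' : c' ∈ C) (h : hammingDist c c' ≤ 2) : c = c' := by
  by_contra hne
  obtain ⟨k, hk⟩ := Function.ne_iff.1 hne
  have h1 : hammingDist (Function.update c k (c' k)) c ≤ 1 := by
    rw [hammingDist, ← Finset.card_singleton k]
    apply Finset.card_le_card
    intro i hi
    simp only [Finset.mem_filter, Finset.mem_univ, true_and] at hi
    by_contra hik
    simp only [Finset.mem_singleton] at hik
    simp [Function.update_of_ne hik] at hi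
  have h2 : hammingDist (Function.update c k (c' k)) c' ≤ 1 := by
    have hs : (Finset.univ.filter fun i => Function.update c k (c' k) i ≠ c' i) ⊆
        (Finset.univ.filter fun i => c i ≠ c' i).erase k := by
      intro i hi
      simp only [Finset.mem_filter, Finset.mem_univ, true_and] at hi
      have hik : i ≠ k := by
        rintro rfl
        simp at hi
      rw [Function.update_of_ne hik] at hi
      simp [hik, hi]
    have := Finset.card_le_card hs
    rw [Finset.card_erase_of_mem (by simpa using hk)] at this
    simp only [hammingDist] at h ⊢
    omega
  exact hne ((hC _).unique ⟨hc, h1⟩ ⟨hc', h2⟩)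

/-! ### The uniqueness of the lengthening -/

def adj (x y : ℕ) : Bool := !(Nat.beq x y) && Nat.ble (hd x y) 2

/-- distance check for one offset -/
def chkE (t : List ℕ) (o : ℕ) : Bool :=
  t.all fun m => Nat.blt (Nat.xor m o) 256 && t.all fun u => Nat.ble 2 (hd (Nat.xor m o) u)

def chkD (t : List ℕ) (m0 o q r : ℕ) : Bool :=
  t.all fun m => t.any fun u =>
    adj (Nat.xor m o) (Nat.xor u q) && adj (Nat.xor m0 o) (Nat.xor u q) && t.any fun v =>
      adj (Nat.xor m o) (Nat.xor v r) && adj (Nat.xor m0 o) (Nat.xor v r) &&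
        adj (Nat.xor u q) (Nat.xor v r)

def chk (t : List ℕ) (o : ℕ × ℕ × ℕ) : Bool :=
  t.contains (t.headD 0) && t.all (fun m => Nat.blt m 256) &&
  chkE t o.1 && chkE t o.2.1 && chkE t o.2.2 &&
  chkD t (t.headD 0) o.1 o.2.1 o.2.2 && chkD t (t.headD 0) o.2.1 o.1 o.2.2 &&
  chkD t (t.headD 0) o.2.2 o.1 o.2.1

theorem chk_all : ∀ i : Fin 7, chk (tb i) (off i) = true := by decide +kernel

def Shadow (C : Finset (Fin 5 → Fin 4)) (M : ℕ) : Prop :=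
  ∀ n, M.testBit n = true → ∃ c ∈ C, enc5 c = n

theorem Shadow.lor {C : Finset (Fin 5 → Fin 4)} {M N : ℕ} (h : Shadow C M) (h' : Shadow C N) :
    Shadow C (Nat.lor M N) := by
  intro n hn
  have : (M ||| N).testBit n = true := hn
  rw [Nat.testBit_or, Bool.or_eq_true] at this
  exact this.elim (h n) (h' n)

theorem shadow_piece {C : Finset (Fin 5 → Fin 4)} (t : List ℕ) (o : ℕ) (j : Fin 5) (b : Fin 4)
    (ho : ∀ m ∈ t, Nat.xor m o < 256)
    (h : ∀ m ∈ t, (j.insertNth b (dec (Nat.xor m o)) : Fin 5 → Fin 4) ∈ C) :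
    Shadow C (piece t o j b) := by
  induction t with
  | nil => intro n hn; simp [piece] at hn
  | cons m t ih =>
    have h1 : piece (m :: t) o j b =
      Nat.lor (Nat.shiftLeft 1 (ins j b (Nat.xor m o))) (piece t o j b) := rfl
    rw [h1]
    refine Shadow.lor ?_ (ih (fun m hm => ho m (by simp [hm])) (fun m hm => h m (by simp [hm])))
    intro n hn
    have h2 : (1 <<< (ins j b (Nat.xor m o))).testBit n = true := hn
    rw [Nat.one_shiftLeft, Nat.testBit_two_pow] at h2
    refine ⟨_, h m (by simp), ?_⟩
    rw [enc5_ins, enc_dec _ (ho m (by simp))]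
    simpa using h2

theorem shadow_disj {C D : Finset (Fin 5 → Fin 4)} {M N : ℕ} (h : Shadow C M) (h' : Shadow D N)
    (hd : Disjoint C D) : Nat.land M N = 0 := by
  apply Nat.eq_of_testBit_eq
  intro n
  have e : (Nat.land M N).testBit n = (M.testBit n && N.testBit n) := Nat.testBit_and M N n
  rw [e, Nat.zero_testBit]
  by_contra hn
  simp only [Bool.not_eq_false, Bool.and_eq_true] at hn
  obtain ⟨c, hc, e1⟩ := h n hn.1
  obtain ⟨d, hd', e2⟩ := h' n hn.2
  have : c = d := enc5_inj (e1.trans e2.symm)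
  subst this
  exact Finset.disjoint_left.1 hd hc hd'

theorem mem_perms : ∀ a b c d : Fin 4, a ≠ b → a ≠ c → a ≠ d → b ≠ c → b ≠ d → c ≠ d →
    ((a : ℕ), (b : ℕ), (c : ℕ), (d : ℕ)) ∈ perms := by decide

theorem three_col : ∀ a b c x y : Fin 4, a ≠ x → a ≠ y → b ≠ x → b ≠ y → x ≠ y → c ≠ a → c ≠ b →
    c ≠ x → c ≠ y → a = b := by
  intro a b c x y
  omega

def code (t : List ℕ) : Finset (Fin 4 → Fin 4) := Finset.univ.filter fun x => enc x ∈ t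

theorem adj_iff (x y : ℕ) : adj x y = true ↔ x ≠ y ∧ hd x y ≤ 2 := by
  rw [adj, Bool.and_eq_true, Nat.ble_eq, Bool.not_eq_true', ← Bool.not_eq_true, Nat.beq_eq]

theorem xor_zero' (m : ℕ) : Nat.xor m 0 = m := Nat.xor_zero m

theorem extend (t : List ℕ) (o : ℕ × ℕ × ℕ) (hchk : chk t o = true)
    (C : Finset (Fin 5 → Fin 4)) (hC : Perf C) (j : Fin 5) (a : Fin 4)
    (hB : code t = (C.filter (fun c => c j = a)).image
            (fun c => fun k : Fin 4 => c (j.succAbove k))) :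
    ∃ M ∈ cands t o, Shadow C M := by
  obtain ⟨o1, o2, o3⟩ := o
  simp only [chk, Bool.and_eq_true] at hchk
  obtain ⟨⟨⟨⟨⟨⟨⟨h0, hlt⟩, hE1⟩, hE2⟩, hE3⟩, hD1⟩, hD2⟩, hD3⟩ := hchk
  generalize t.headD 0 = m0 at *
  have hm0 : m0 ∈ t := by simpa using h0
  have hlt : ∀ m ∈ t, m < 256 := by simpa [Nat.blt_eq] using hlt
  -- codewords over the code itself
  have hcode : ∀ w, enc w ∈ t → (j.insertNth a w : Fin 5 → Fin 4) ∈ C := by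
    intro w hw
    have : w ∈ code t := by simp [code, hw]
    rw [hB, Finset.mem_image] at this
    obtain ⟨c, hc, rfl⟩ := this
    rw [Finset.mem_filter] at hc
    have e : (j.insertNth a (fun k : Fin 4 => c (j.succAbove k)) : Fin 5 → Fin 4) = c := by
      rw [← hc.2]
      exact Fin.insertNth_self_removeNth j c
    rw [e]; exact hc.1
  have hcode' : ∀ w, (j.insertNth a w : Fin 5 → Fin 4) ∈ C → enc w ∈ t := by
    intro w hw
    have : w ∈ code t := by
      rw [hB, Finset.mem_image]
      exact ⟨_, Finset.mem_filter.2 ⟨hw, by simp⟩, by funext k; simp⟩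
    simpa [code] using this
  have hE : ∀ o, chkE t o = true → (∀ m ∈ t, Nat.xor m o < 256) ∧
      ∀ m ∈ t, ∃ b, b ≠ a ∧ (j.insertNth b (dec (Nat.xor m o)) : Fin 5 → Fin 4) ∈ C := by
    intro o ho
    simp only [chkE, List.all_eq_true, Bool.and_eq_true, Nat.blt_eq, Nat.ble_eq] at ho
    refine ⟨fun m hm => (ho m hm).1, fun m hm => ?_⟩
    obtain ⟨c, ⟨hc, hd1⟩, -⟩ := hC (j.insertNth a (dec (Nat.xor m o)))
    obtain ⟨b, w, rfl⟩ : ∃ b w, c = (j.insertNth b w : Fin 5 → Fin 4) :=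
      ⟨c j, _, (Fin.insertNth_self_removeNth j c).symm⟩
    rw [hd_ins] at hd1
    by_cases hab : b = a
    · subst hab
      have h2 := (ho m hm).2 _ (hcode' w hc)
      rw [hd_enc, enc_dec _ (ho m hm).1] at hd1
      rw [if_neg (by simp)] at hd1
      omega
    · have h3 : hammingDist (dec (Nat.xor m o)) w = 0 := by
        rw [if_pos (Ne.symm hab)] at hd1; omega
      rw [hammingDist_eq_zero] at h3
      exact ⟨b, hab, h3 ▸ hc⟩
  obtain ⟨l1, f1⟩ := hE o1 hE1
  obtain ⟨l2, f2⟩ := hE o2 hE2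
  obtain ⟨l3, f3⟩ := hE o3 hE3
  have hadj : ∀ x y, x < 256 → y < 256 → adj x y = true → ∀ b c : Fin 4,
      (j.insertNth b (dec x) : Fin 5 → Fin 4) ∈ C →
      (j.insertNth c (dec y) : Fin 5 → Fin 4) ∈ C → b ≠ c := by
    rintro x y hx hy hxy b c hb hc rfl
    rw [adj_iff] at hxy
    have h := perf_dist C hC _ _ hb hc (by
      rw [hd_ins, hd_enc, enc_dec x hx, enc_dec y hy]; simpa using hxy.2)
    have h2 : dec x = dec y := by
      have := congrArg (fun f : Fin 5 → Fin 4 => fun k => f (j.succAbove k)) h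
      simpa using this
    apply hxy.1
    rw [← enc_dec x hx, ← enc_dec y hy, h2]
  -- constancy of the symbol on the three parallel codes
  have hconst : ∀ o q r, chkD t m0 o q r = true →
      (∀ m ∈ t, Nat.xor m o < 256) → (∀ m ∈ t, Nat.xor m q < 256) → (∀ m ∈ t, Nat.xor m r < 256) →
      (∀ m ∈ t, ∃ b, b ≠ a ∧ (j.insertNth b (dec (Nat.xor m o)) : Fin 5 → Fin 4) ∈ C) →
      (∀ m ∈ t, ∃ b, b ≠ a ∧ (j.insertNth b (dec (Nat.xor m q)) : Fin 5 → Fin 4) ∈ C) →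
      (∀ m ∈ t, ∃ b, b ≠ a ∧ (j.insertNth b (dec (Nat.xor m r)) : Fin 5 → Fin 4) ∈ C) →
      ∃ s, s ≠ a ∧ ∀ m ∈ t, (j.insertNth s (dec (Nat.xor m o)) : Fin 5 → Fin 4) ∈ C := by
    intro o q r hD lo lq lr fo fq fr
    obtain ⟨s, hs, hsC⟩ := fo m0 hm0
    refine ⟨s, hs, fun m hm => ?_⟩
    simp only [chkD, List.all_eq_true, List.any_eq_true, Bool.and_eq_true] at hD
    obtain ⟨u, hu, ⟨au, au0⟩, v, hv, ⟨av, av0⟩, auv⟩ := hD m hm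
    obtain ⟨b, hb, hbC⟩ := fo m hm
    obtain ⟨x, hx, hxC⟩ := fq u hu
    obtain ⟨y, hy, hyC⟩ := fr v hv
    have e : b = s := three_col b s a x y
      (hadj _ _ (lo m hm) (lq u hu) au _ _ hbC hxC) (hadj _ _ (lo m hm) (lr v hv) av _ _ hbC hyC)
      (hadj _ _ (lo m0 hm0) (lq u hu) au0 _ _ hsC hxC)
      (hadj _ _ (lo m0 hm0) (lr v hv) av0 _ _ hsC hyC)
      (hadj _ _ (lq u hu) (lr v hv) auv _ _ hxC hyC) hb.symm hs.symm hx.symm hy.symm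
    exact e ▸ hbC
  obtain ⟨s1, n1, c1⟩ := hconst o1 o2 o3 hD1 l1 l2 l3 f1 f2 f3
  obtain ⟨s2, n2, c2⟩ := hconst o2 o1 o3 hD2 l2 l1 l3 f2 f1 f3
  obtain ⟨s3, n3, c3⟩ := hconst o3 o1 o2 hD3 l3 l1 l2 f3 f1 f2
  simp only [chkD, List.all_eq_true, List.any_eq_true, Bool.and_eq_true] at hD1
  obtain ⟨u, hu, ⟨au, -⟩, v, hv, ⟨av, -⟩, auv⟩ := hD1 m0 hm0
  have n12 := hadj _ _ (l1 m0 hm0) (l2 u hu) au _ _ (c1 m0 hm0) (c2 u hu)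
  have n13 := hadj _ _ (l1 m0 hm0) (l3 v hv) av _ _ (c1 m0 hm0) (c3 v hv)
  have n23 := hadj _ _ (l2 u hu) (l3 v hv) auv _ _ (c2 u hu) (c3 v hv)
  refine ⟨cand t (o1, o2, o3) j (a, s1, s2, s3), ?_, ?_⟩
  · rw [cands, List.mem_flatMap]
    refine ⟨j, ?_, List.mem_map_of_mem (mem_perms a s1 s2 s3 n1.symm n2.symm n3.symm n12 n13 n23)⟩
    clear * -
    revert j; decide
  · refine Shadow.lor (Shadow.lor ?_ ?_) (Shadow.lor ?_ ?_)
    · refine shadow_piece t 0 j a (fun m hm => ?_) (fun m hm => ?_)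
      · rw [xor_zero']; exact hlt m hm
      · rw [xor_zero']
        apply hcode
        rw [enc_dec _ (hlt m hm)]; exact hm
    · exact shadow_piece t o1 j s1 l1 c1
    · exact shadow_piece t o2 j s2 l2 c2
    · exact shadow_piece t o3 j s3 l3 c3

theorem no_ext (C : Fin 16 → Finset (Fin 5 → Fin 4)) (hC : ∀ i, Perf (C i))
    (hd : ∀ i j, i ≠ j → Disjoint (C i) (C j))
    (hB : ∀ i : Fin 16, ∃ (j : Fin 5) (a : Fin 4),
          code (tb i) = ((C i).filter (fun c => c j = a)).image
            (fun c => fun k : Fin 4 => c (j.succAbove k))) : False := by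
  have h : ∀ i : Fin 7, ∃ M ∈ cands (tb i) (off i), Shadow (C (Fin.castLE (by omega) i)) M := by
    intro i
    obtain ⟨j, a, h⟩ := hB (Fin.castLE (by omega) i)
    exact extend (tb i) (off i) (chk_all i) _ (hC _) j a h
  choose M hM hS using h
  have hp : ∀ i j : Fin 7, i ≠ j → Nat.land (M i) (M j) = 0 := fun i j hij =>
    shadow_disj (hS i) (hS j) (hd _ _ (fun e => hij (Fin.castLE_injective _ e)))
  have hm : List.Forall₂ (· ∈ ·) [M 0, M 1, M 2, M 3, M 4, M 5, M 6] seven :=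
    .cons (hM 0) (.cons (hM 1) (.cons (hM 2) (.cons (hM 3) (.cons (hM 4) (.cons (hM 5)
      (.cons (hM 6) .nil))))))
  obtain ⟨Ls', h1, h2⟩ := forceA_sound _ _ big _ hm
  refine refute_sound 7 Ls' h1 _ h2 ?_
  have e : [M 0, M 1, M 2, M 3, M 4, M 5, M 6] = List.ofFn M := by simp [List.ofFn_succ]
  rw [e, List.pairwise_ofFn]
  exact fun i j hij => hp i j hij.ne

/-! ### The partition -/

theorem tb_disj : ∀ i j : Fin 16, i ≠ j → ∀ n ∈ tb i, n ∉ tb j := by decide +kernel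
theorem tb_cover : ∀ n : Fin 256, ∃ i : Fin 16, (n : ℕ) ∈ tb i := by decide +kernel
theorem tb_lt : ∀ i : Fin 16, ∀ n ∈ tb i, n < 256 := by decide +kernel
theorem tb_card : ∀ i : Fin 16, (tb i).toFinset.card = 16 := by decide +kernel
theorem tb_dist : ∀ i : Fin 16, ∀ n ∈ tb i, ∀ m ∈ tb i, n ≠ m → 3 ≤ hd n m := by decide +kernel

end Part18



/-- There exists a partition of H(4,4) into sixteen (4,16,3)₄ codes that cannot
be lengthened to a partition of H(5,4) into sixteen 1-perfect codes. -/
theorem stmt_18 :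
    ∃ B : Fin 16 → Finset (Fin 4 → Fin 4),
      (∀ i j, i ≠ j → Disjoint (B i) (B j)) ∧
      (Finset.univ.biUnion B = Finset.univ) ∧
      (∀ i, (B i).card = 16) ∧
      (∀ i, ∀ x ∈ B i, ∀ y ∈ B i, x ≠ y → 3 ≤ hammingDist x y) ∧
      ¬ ∃ C : Fin 16 → Finset (Fin 5 → Fin 4),
        (∀ i, ∀ x : Fin 5 → Fin 4, ∃! c, c ∈ C i ∧ hammingDist x c ≤ 1) ∧
        (∀ i j, i ≠ j → Disjoint (C i) (C j)) ∧
        (Finset.univ.biUnion C = Finset.univ) ∧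
        (∀ i, ∃ (j : Fin 5) (a : Fin 4),
          B i = ((C i).filter (fun c => c j = a)).image
            (fun c => fun k : Fin 4 => c (j.succAbove k))) := by
  refine ⟨fun i => Part18.code (Part18.tb i), ?_, ?_, ?_, ?_, ?_⟩
  · intro i j hij
    rw [Finset.disjoint_left]
    intro x hx hy
    simp only [Part18.code, Finset.mem_filter, Finset.mem_univ, true_and] at hx hy
    exact Part18.tb_disj i j hij _ hx hy
  · ext x
    obtain ⟨i, hi⟩ := Part18.tb_cover ⟨Part18.enc x, Part18.enc_lt x⟩
    simp only [Finset.mem_biUnion, Finset.mem_univ, true_and, iff_true]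
    exact ⟨i, by simpa [Part18.code] using hi⟩
  · intro i
    refine Eq.trans ?_ (Part18.tb_card i)
    rw [← Finset.card_image_of_injective _ Part18.enc_inj]
    congr 1
    ext n
    simp only [Part18.code, Finset.mem_image, Finset.mem_filter, Finset.mem_univ, true_and,
      List.mem_toFinset]
    constructor
    · rintro ⟨x, hx, rfl⟩
      exact hx
    · intro hn
      have := Part18.enc_dec n (Part18.tb_lt i n hn)
      exact ⟨Part18.dec n, by rw [this]; exact hn, this⟩
  · intro i x hx y hy hxy
    simp only [Part18.code, Finset.mem_filter, Finset.mem_univ, true_and] at hx hy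
    rw [Part18.hd_enc]
    exact Part18.tb_dist i _ hx _ hy (fun e => hxy (Part18.enc_inj e))
  · rintro ⟨C, hC, hd, -, hB⟩
    exact Part18.no_ext C hC hd hB
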